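/- Let f(x) = (x¹² + 24x¹¹ + 204x¹⁰ + 912x⁹ + 2676x⁸ + 4032x⁷ + 9056x⁶ − 1920x⁵ + 7728x⁴ − 16512x³ − 20544x² − 6912x − 1088) − t·(x² − 2)³·(x³ + 3x² + 6x + 2), a polynomial of degree 12 in x with coefficients in ℚ(t). Then the Galois group of (the splitting field of) f over ℚ(t) is a simple group of cardinality 7920 (i.e., it is isomorphic to the Mathieu group M₁₁). -/

import Mathlib

open Polynomial

/-- The generator `t` of the rational function field `ℚ(t)`. -/
noncomputable def t : RatFunc ℚ := RatFunc.X

/-- `f(x) = (x¹² + 24x¹¹ + 204x¹⁰ + 912x⁹ + 2676x⁸ + 4032x⁷ + 9056x⁶ − 1920x⁵ + 7728x⁴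
  − 16512x³ − 20544x² − 6912x − 1088) − t(x²−2)³(x³+3x²+6x+2)` over `ℚ(t)`. -/
noncomputable def f : Polynomial (RatFunc ℚ) :=
  (X ^ 12 + 24 * X ^ 11 + 204 * X ^ 10 + 912 * X ^ 9 + 2676 * X ^ 8 + 4032 * X ^ 7 +
      9056 * X ^ 6 - 1920 * X ^ 5 + 7728 * X ^ 4 - 16512 * X ^ 3 - 20544 * X ^ 2 -
      6912 * X - 1088) -
    C t * ((X ^ 2 - 2) ^ 3 * (X ^ 3 + 3 * X ^ 2 + 6 * X + 2))


namespace M11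

/-- Bit masks of the 22 blocks. -/
def masks : Fin 22 → ℕ := ![948, 3238, 2445, 3873, 2362, 1733, 1085, 2668, 857, 222, 3147, 2583,
  3412, 1427, 3010, 359, 1512, 683, 1650, 2289, 3736, 1806]

def inc (j : Fin 22) (i : Fin 12) : Bool := (masks j).testBit i

def rowMask : Fin 11 → ℕ := ![2445, 3873, 1733, 1085, 857, 3147, 2583, 1427, 359, 683, 2289]

def row (j : Fin 11) (i : Fin 12) : Bool := (rowMask j).testBit i

abbrev P12 := Equiv.Perm (Fin 12)

/-- Automorphisms of the design. -/
def Γ : Subgroup P12 where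
  carrier := {σ | ∀ j, ∃ j', ∀ i, inc j' (σ i) = inc j i}
  one_mem' := fun j => ⟨j, fun i => rfl⟩
  mul_mem' := by
    intro a b ha hb j
    obtain ⟨k, hk⟩ := hb j
    obtain ⟨l, hl⟩ := ha k
    exact ⟨l, fun i => by rw [Equiv.Perm.mul_apply, hl, hk]⟩
  inv_mem' := by
    intro a ha j
    have key : ∀ n : ℕ, ∀ j, ∃ j', ∀ i, inc j' ((a ^ n) i) = inc j i := by
      intro n
      induction n with
      | zero => exact fun j => ⟨j, fun i => rfl⟩
      | succ n ih =>
        intro j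
        obtain ⟨k, hk⟩ := ha j
        obtain ⟨l, hl⟩ := ih k
        exact ⟨l, fun i => by rw [pow_succ, Equiv.Perm.mul_apply, hl, hk]⟩
    have h1 : a⁻¹ = a ^ (orderOf a - 1) := by
      rw [inv_eq_iff_mul_eq_one, ← pow_succ', Nat.sub_add_cancel (orderOf_pos a), pow_orderOf_eq_one]
    rw [h1]
    exact key _ j

theorem mem_Γ {σ : P12} : σ ∈ Γ ↔ ∀ j, ∃ j', ∀ i, inc j' (σ i) = inc j i := Iff.rfl

def stab (a : Fin 12) : Subgroup P12 := MulAction.stabilizer P12 a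

theorem mem_stab {a : Fin 12} {σ : P12} : σ ∈ stab a ↔ σ a = a := Iff.rfl

theorem card_orb (X : Subgroup P12) (a : Fin 12) :
    Nat.card X = (MulAction.orbit X a).ncard * Nat.card (X ⊓ stab a : Subgroup P12) := by
  rw [← MulAction.index_stabilizer, mul_comm]
  rw [← Subgroup.card_mul_index (MulAction.stabilizer X a)]
  congr 1
  refine Nat.card_congr ⟨fun x => ⟨x.1.1, x.1.2, x.2⟩, fun x => ⟨⟨x.1, x.2.1⟩, x.2.2⟩, ?_, ?_⟩
  · intro x; rfl
  · intro x; rfl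

theorem card_up (X : Subgroup P12) (a : Fin 12) (S : Finset (Fin 12))
    (h : ∀ σ ∈ X, σ a ∈ S) :
    Nat.card X ≤ S.card * Nat.card (X ⊓ stab a : Subgroup P12) := by
  rw [card_orb X a]
  gcongr
  rw [← Set.ncard_coe_finset]
  apply Set.ncard_le_ncard _ (Finset.finite_toSet S)
  rintro _ ⟨x, rfl⟩
  exact h x.1 x.2

theorem card_low (X : Subgroup P12) (a : Fin 12) (S : Finset (Fin 12))
    (h : ∀ k ∈ S, ∃ σ ∈ X, σ a = k) :
    S.card * Nat.card (X ⊓ stab a : Subgroup P12) ≤ Nat.card X := by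
  rw [card_orb X a]
  gcongr
  rw [← Set.ncard_coe_finset]
  apply Set.ncard_le_ncard _ (Set.toFinite _)
  intro k hk
  obtain ⟨σ, h1, h2⟩ := h k hk
  exact ⟨⟨σ, h1⟩, h2⟩

def fixB : Finset (Fin 22) := Finset.univ.filter fun j =>
  ∀ j', (inc j' 0 = inc j 0 ∧ inc j' 1 = inc j 1 ∧ inc j' 2 = inc j 2 ∧ inc j' 4 = inc j 4) → j' = j

theorem refine1 : ∀ i k : Fin 12, i ∈ ({0,1,2,3,4,5,6,7,8,10} : Finset (Fin 12)) →
    (∀ j ∈ fixB, inc j k = inc j i) → k = i := by decide +kernel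

theorem refine2 : ∀ j j' : Fin 22,
    (∀ i ∈ ({0,1,2,3,4,5,6,7,8,10} : Finset (Fin 12)), inc j' i = inc j i) → j' = j := by
  decide +kernel

theorem refine3 : ∀ i k : Fin 12, (∀ j, inc j k = inc j i) → k = i := by decide +kernel

theorem fix4 (σ : P12) (h : σ ∈ Γ) (h0 : σ 0 = 0) (h1 : σ 1 = 1) (h2 : σ 2 = 2) (h4 : σ 4 = 4) :
    σ = 1 := by
  have hB : ∀ j ∈ fixB, ∀ i, inc j (σ i) = inc j i := by
    intro j hj i
    obtain ⟨j', hj'⟩ := h j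
    have : j' = j := by
      have := (Finset.mem_filter.1 hj).2 j'
      apply this
      refine ⟨?_, ?_, ?_, ?_⟩
      · rw [← hj' 0, h0]
      · rw [← hj' 1, h1]
      · rw [← hj' 2, h2]
      · rw [← hj' 4, h4]
    rw [← hj' i, this]
  have hP : ∀ i ∈ ({0,1,2,3,4,5,6,7,8,10} : Finset (Fin 12)), σ i = i :=
    fun i hi => refine1 i (σ i) hi fun j hj => hB j hj i
  have hB2 : ∀ j, ∀ i, inc j (σ i) = inc j i := by
    intro j i
    obtain ⟨j', hj'⟩ := h j
    have : j' = j := refine2 j j' fun i hi => by rw [← hj' i, hP i hi]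
    rw [← hj' i, this]
  ext1 i
  exact refine3 i (σ i) fun j => hB2 j i

theorem coblock : ∀ j : Fin 22, ∀ k : Fin 12, inc j 0 = true → inc j 1 = true → inc j 2 = true →
    inc j k = true → k ≠ 0 → k ≠ 1 → k ≠ 2 → k ∈ ({4, 9, 11, 5, 6, 8} : Finset (Fin 12)) := by
  decide +kernel

theorem card_Γ_le : Nat.card Γ ≤ 7920 := by
  have e1 := card_up Γ 0 Finset.univ (fun _ _ => Finset.mem_univ _)
  have e2 := card_up (Γ ⊓ stab 0) 1 {1,2,3,4,5,6,7,8,9,10,11} (by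
    intro σ hσ
    have h0 : σ 0 = 0 := hσ.2
    have : σ 1 ≠ 0 := fun h => by
      have := σ.injective (h.trans h0.symm)
      revert this; decide
    revert this
    generalize σ 1 = k
    revert k; decide)
  have e3 := card_up (Γ ⊓ stab 0 ⊓ stab 1) 2 {2,3,4,5,6,7,8,9,10,11} (by
    intro σ hσ
    have h0 : σ 0 = 0 := hσ.1.2
    have h1 : σ 1 = 1 := hσ.2
    have a : σ 2 ≠ 0 := fun h => by
      have := σ.injective (h.trans h0.symm)
      revert this; decide
    have b : σ 2 ≠ 1 := fun h => by
      have := σ.injective (h.trans h1.symm)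
      revert this; decide
    revert a b
    generalize σ 2 = k
    revert k; decide)
  have e4 := card_up (Γ ⊓ stab 0 ⊓ stab 1 ⊓ stab 2) 4 {4, 9, 11, 5, 6, 8} (by
    intro σ hσ
    have h0 : σ 0 = 0 := hσ.1.1.2
    have h1 : σ 1 = 1 := hσ.1.2
    have h2 : σ 2 = 2 := hσ.2
    obtain ⟨j', hj'⟩ := hσ.1.1.1 11
    have a0 := hj' 0
    have a1 := hj' 1
    have a2 := hj' 2
    rw [h0] at a0; rw [h1] at a1; rw [h2] at a2
    refine coblock j' (σ 4) (a0.trans (by decide)) (a1.trans (by decide)) (a2.trans (by decide))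
      ((hj' 4).trans (by decide)) ?_ ?_ ?_
    · intro h
      have := σ.injective (h.trans h0.symm)
      revert this; decide
    · intro h
      have := σ.injective (h.trans h1.symm)
      revert this; decide
    · intro h
      have := σ.injective (h.trans h2.symm)
      revert this; decide)
  have e5 : Nat.card (Γ ⊓ stab 0 ⊓ stab 1 ⊓ stab 2 ⊓ stab 4 : Subgroup P12) = 1 := by
    rw [Subgroup.card_eq_one, eq_bot_iff]
    intro σ hσ
    exact fix4 σ hσ.1.1.1.1 hσ.1.1.1.2 hσ.1.1.2 hσ.1.2 hσ.2
  rw [e5] at e4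
  have c1 : (Finset.univ : Finset (Fin 12)).card = 12 := rfl
  have c2 : ({1,2,3,4,5,6,7,8,9,10,11} : Finset (Fin 12)).card = 11 := rfl
  have c3 : ({2,3,4,5,6,7,8,9,10,11} : Finset (Fin 12)).card = 10 := rfl
  have c4 : ({4, 9, 11, 5, 6, 8} : Finset (Fin 12)).card = 6 := rfl
  rw [c1] at e1; rw [c2] at e2; rw [c3] at e3; rw [c4] at e4
  omega

def ss : P12 where
  toFun := ![0, 2, 4, 7, 5, 11, 9, 8, 1, 3, 6, 10]
  invFun := ![0, 8, 1, 9, 2, 4, 10, 3, 7, 6, 11, 5]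
  left_inv := by intro i; revert i; decide
  right_inv := by intro i; revert i; decide

def uu : P12 where
  toFun := ![1, 2, 3, 5, 9, 7, 6, 11, 4, 10, 0, 8]
  invFun := ![10, 0, 1, 2, 8, 3, 6, 5, 11, 4, 9, 7]
  left_inv := by intro i; revert i; decide
  right_inv := by intro i; revert i; decide

theorem ss_mem : ss ∈ Γ := by rw [mem_Γ]; decide +kernel
theorem uu_mem : uu ∈ Γ := by rw [mem_Γ]; decide +kernel
theorem ss_pow : ss ^ 11 = 1 := by decide +kernel
theorem uu_pow : uu ^ 11 = 1 := by decide +kernel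

def ee : P12 := ss * uu ^ 3 * ss ^ 2 * uu
def gg : P12 := uu ^ 5 * ss * uu ^ 4
def zz : P12 := uu ^ 6 * ss * uu ^ 3
def jj : P12 := uu ^ 6 * ss ^ 6 * uu ^ 4

theorem low_aux (X : Subgroup P12) (hs : ss ∈ X) (hu : uu ∈ X) : 7920 ≤ Nat.card X := by
  have he : ee ∈ X := X.mul_mem (X.mul_mem (X.mul_mem hs (X.pow_mem hu _)) (X.pow_mem hs _)) hu
  have hg : gg ∈ X := X.mul_mem (X.mul_mem (X.pow_mem hu _) hs) (X.pow_mem hu _)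
  have hz : zz ∈ X := X.mul_mem (X.mul_mem (X.pow_mem hu _) hs) (X.pow_mem hu _)
  have hj : jj ∈ X := X.mul_mem (X.mul_mem (X.pow_mem hu _) (X.pow_mem hs _)) (X.pow_mem hu _)
  have f1 : ∀ k : Fin 12, ∃ m : Fin 2, ∃ i : Fin 11, (ss ^ (m : ℕ) * uu ^ (i : ℕ)) 0 = k := by
    decide +kernel
  have f2 : ∀ k ∈ ({1,2,3,4,5,6,7,8,9,10,11} : Finset (Fin 12)), ∃ i : Fin 11,
    (ss ^ (i : ℕ)) 1 = k := by decide +kernel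
  have f3 : ∀ k ∈ ({2,3,4,5,6,7,8,9,10,11} : Finset (Fin 12)), ∃ i : Fin 5, ∃ m : Fin 2,
    (ee ^ (i : ℕ) * gg ^ (m : ℕ)) 2 = k := by decide +kernel
  have f4 : ∀ k ∈ ({4, 9, 11, 5, 6, 8} : Finset (Fin 12)), ∃ i : Fin 3, ∃ m : Fin 2,
    (zz ^ (i : ℕ) * jj ^ (m : ℕ)) 4 = k := by decide +kernel
  have e1 := card_low X 0 Finset.univ (by
    intro k _
    obtain ⟨m, i, h⟩ := f1 k
    exact ⟨_, X.mul_mem (X.pow_mem hs _) (X.pow_mem hu _), h⟩)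
  have s0 : ss ∈ X ⊓ stab 0 := ⟨hs, mem_stab.2 (by decide +kernel)⟩
  have e2 := card_low (X ⊓ stab 0) 1 {1,2,3,4,5,6,7,8,9,10,11} (by
    intro k hk
    obtain ⟨i, h⟩ := f2 k hk
    exact ⟨_, pow_mem s0 _, h⟩)
  have e0 : ee ∈ X ⊓ stab 0 ⊓ stab 1 := ⟨⟨he, mem_stab.2 (by decide +kernel)⟩,
    mem_stab.2 (by decide +kernel)⟩
  have g0 : gg ∈ X ⊓ stab 0 ⊓ stab 1 := ⟨⟨hg, mem_stab.2 (by decide +kernel)⟩,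
    mem_stab.2 (by decide +kernel)⟩
  have e3 := card_low (X ⊓ stab 0 ⊓ stab 1) 2 {2,3,4,5,6,7,8,9,10,11} (by
    intro k hk
    obtain ⟨i, m, h⟩ := f3 k hk
    exact ⟨_, mul_mem (pow_mem e0 _) (pow_mem g0 _), h⟩)
  have z0 : zz ∈ X ⊓ stab 0 ⊓ stab 1 ⊓ stab 2 := ⟨⟨⟨hz, mem_stab.2 (by decide +kernel)⟩,
    mem_stab.2 (by decide +kernel)⟩, mem_stab.2 (by decide +kernel)⟩
  have j0 : jj ∈ X ⊓ stab 0 ⊓ stab 1 ⊓ stab 2 := ⟨⟨⟨hj, mem_stab.2 (by decide +kernel)⟩,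
    mem_stab.2 (by decide +kernel)⟩, mem_stab.2 (by decide +kernel)⟩
  have e4 := card_low (X ⊓ stab 0 ⊓ stab 1 ⊓ stab 2) 4 {4, 9, 11, 5, 6, 8} (by
    intro k hk
    obtain ⟨i, m, h⟩ := f4 k hk
    exact ⟨_, mul_mem (pow_mem z0 _) (pow_mem j0 _), h⟩)
  have e5 : 0 < Nat.card (X ⊓ stab 0 ⊓ stab 1 ⊓ stab 2 ⊓ stab 4 : Subgroup P12) := Nat.card_pos
  have c1 : (Finset.univ : Finset (Fin 12)).card = 12 := rfl
  have c2 : ({1,2,3,4,5,6,7,8,9,10,11} : Finset (Fin 12)).card = 11 := rfl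
  have c3 : ({2,3,4,5,6,7,8,9,10,11} : Finset (Fin 12)).card = 10 := rfl
  have c4 : ({4, 9, 11, 5, 6, 8} : Finset (Fin 12)).card = 6 := rfl
  rw [c1] at e1; rw [c2] at e2; rw [c3] at e3; rw [c4] at e4
  omega

theorem card_Γ : Nat.card Γ = 7920 := le_antisymm card_Γ_le (low_aux Γ ss_mem uu_mem)

/-- A subgroup of `Γ` whose order is divisible by 1320 is everything. -/
theorem eq_Γ (X : Subgroup P12) (hX : X ≤ Γ) (hc : 1320 ∣ Nat.card X) : X = Γ := by
  have h1 : Nat.card X * X.relIndex Γ = 7920 := by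
    rw [← card_Γ, ← Subgroup.card_mul_index (X.subgroupOf Γ)]
    congr 1
    exact (Nat.card_congr (Subgroup.subgroupOfEquivOfLe hX).toEquiv).symm
  have h2 : X.relIndex Γ ≠ 0 := fun h => by simp [h] at h1
  have h3 : X.relIndex Γ ≤ 6 := by
    obtain ⟨k, hk⟩ := hc
    have : k ≠ 0 := by rintro rfl; simp [hk] at h1
    have : 1 ≤ k := Nat.one_le_iff_ne_zero.2 this
    rw [hk] at h1
    nlinarith
  have key : ∀ x ∈ Γ, x ^ 11 = 1 → x ∈ X := by
    intro x hx h11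
    obtain ⟨n, hn0, hn, hm⟩ := Subgroup.exists_pow_mem_of_index_ne_zero
      (H := X.subgroupOf Γ) h2 ⟨x, hx⟩
    have hn' : n ≤ 6 := hn.trans h3
    have hm' : x ^ n ∈ X := hm
    have : Nat.Coprime n 11 := by
      apply Nat.Coprime.symm
      rw [Nat.Prime.coprime_iff_not_dvd (by norm_num)]
      intro h
      have := Nat.le_of_dvd hn0 h
      omega
    have hb := Nat.gcd_eq_gcd_ab n 11
    rw [this] at hb
    have : x = (x ^ n) ^ (n.gcdA 11) * (x ^ 11) ^ (n.gcdB 11) := by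
      rw [← zpow_natCast, ← zpow_natCast, ← zpow_mul, ← zpow_mul, ← zpow_add, ← hb]; simp
    rw [this, h11, one_zpow, mul_one]
    exact zpow_mem hm' _
  have h4 := low_aux X (key _ ss_mem ss_pow) (key _ uu_mem uu_pow)
  exact Subgroup.eq_of_le_of_card_ge hX (by rw [card_Γ]; exact h4)

def EE (j : Fin 11) : Finset (Fin 12 × Fin 12) :=
  Finset.univ.filter fun p => row j p.1 = row j p.2

open scoped Pointwise

theorem EE_img (σ : P12) (hσ : σ ∈ Γ) (j : Fin 11) : ∃ j', σ • EE j = EE j' := by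
  have h1 : ∀ j : Fin 11, ∃ k : Fin 22, ∀ i, inc k i = row j i := by decide +kernel
  have h2 : ∀ k : Fin 22, ∃ j : Fin 11, ∀ i, ∀ i', (inc k i = inc k i') ↔ (row j i = row j i') := by
    decide +kernel
  obtain ⟨k, hk⟩ := h1 j
  obtain ⟨l, hl⟩ := hσ k
  obtain ⟨j', hj'⟩ := h2 l
  refine ⟨j', ?_⟩
  ext ⟨a, b⟩
  rw [← Finset.inv_smul_mem_iff]
  simp only [EE, Finset.mem_filter, Finset.mem_univ, true_and]
  rw [← hj', ← hk, ← hk, ← hl, ← hl]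
  simp

theorem faithful : ∀ i a b : Fin 12, i ≠ 0 → (∀ j, (row j a = row j b) ↔ (row j 0 = row j i)) →
    (a = 0 ∧ b = i) ∨ (a = i ∧ b = 0) := by decide +kernel

theorem EE_fix (σ : P12) (h : ∀ j, σ • EE j = EE j) : σ = 1 := by
  have h1 : ∀ i, i ≠ 0 → (σ 0 = 0 ∧ σ i = i) ∨ (σ 0 = i ∧ σ i = 0) := by
    intro i hi
    apply faithful _ _ _ hi
    intro j
    have : ((0, i) : Fin 12 × Fin 12) ∈ EE j ↔ σ • ((0, i) : Fin 12 × Fin 12) ∈ EE j := by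
      conv_rhs => rw [← h j]
      exact (Finset.smul_mem_smul_finset_iff σ).symm
    simpa [EE] using this.symm
  have h0 : σ 0 = 0 := by
    rcases h1 1 (by decide) with h | h
    · exact h.1
    · rcases h1 2 (by decide) with h' | h'
      · exact h'.1
      · have := h.1.symm.trans h'.1
        exact absurd this (by decide)
  ext1 i
  by_cases hi : i = 0
  · rw [hi, h0]; rfl
  rcases h1 i hi with h | h
  · exact h.2
  · exact absurd (h.1.symm.trans h0) hi

theorem EE_inj : Function.Injective EE := by
  have : ∀ j k : Fin 11, (∀ i, row j 0 = row j i ↔ row k 0 = row k i) → j = k := by decide +kernel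
  intro j k h
  apply this
  intro i
  have := Finset.ext_iff.1 h (0, i)
  simpa [EE] using this

theorem row_ss : ∀ k : Fin 11, ∃ m : Fin 11, ∀ a b,
    row k ((ss ^ (m : ℕ)) a) = row k ((ss ^ (m : ℕ)) b) ↔ row 0 a = row 0 b := by decide +kernel

theorem EE_trans (k : Fin 11) : ∃ σ ∈ Γ, σ • EE 0 = EE k := by
  obtain ⟨m, hm⟩ := row_ss k
  refine ⟨ss ^ (m : ℕ), pow_mem ss_mem _, ?_⟩
  ext ⟨a, b⟩
  rw [← Finset.inv_smul_mem_iff]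
  simp only [EE, Finset.mem_filter, Finset.mem_univ, true_and]
  rw [← hm]
  simp

theorem orbEE : MulAction.orbit Γ (EE 0) = Set.range EE := by
  ext x
  constructor
  · rintro ⟨σ, rfl⟩
    obtain ⟨j, hj⟩ := EE_img σ.1 σ.2 0
    exact ⟨j, hj.symm⟩
  · rintro ⟨k, rfl⟩
    obtain ⟨σ, h, hk⟩ := EE_trans k
    exact ⟨⟨σ, h⟩, hk⟩

theorem simple_Γ : IsSimpleGroup Γ := by
  have hn : Nontrivial Γ := by
    rw [← Finite.one_lt_card_iff_nontrivial, card_Γ]; norm_num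
  refine { exists_pair_ne := hn.exists_pair_ne, eq_bot_or_eq_top_of_normal := ?_ }
  intro N hN
  by_cases hb : N = ⊥
  · exact Or.inl hb
  right
  set K := MulAction.stabilizer Γ (EE 0) with hK
  have hKi : K.index = 11 := by
    rw [hK, MulAction.index_stabilizer, orbEE, ← Set.image_univ,
      Set.ncard_image_of_injective _ EE_inj]
    simp
  have hNK : ¬ N ≤ K := by
    intro hle
    apply hb
    rw [eq_bot_iff]
    intro n hn
    rw [Subgroup.mem_bot]
    apply Subtype.ext
    apply EE_fix
    intro j
    obtain ⟨σ, h, hk⟩ := EE_trans j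
    have h2 : (⟨σ, h⟩ : Γ)⁻¹ * n * (⟨σ, h⟩ : Γ)⁻¹⁻¹ ∈ K := hle (hN.conj_mem n hn _)
    rw [hK, MulAction.mem_stabilizer_iff] at h2
    have h3 : (σ⁻¹ * n.1 * σ⁻¹⁻¹) • EE 0 = EE 0 := h2
    rw [inv_inv, mul_smul, mul_smul, hk, inv_smul_eq_iff, hk] at h3
    exact h3
  have h11 : 11 ∣ Nat.card N := by
    have hlt : K < N ⊔ K := lt_of_le_of_ne le_sup_right (fun h => hNK (h ▸ le_sup_left))
    have h1 := Subgroup.relIndex_mul_index (le_of_lt hlt)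
    rw [hKi] at h1
    have h2 : K.relIndex (N ⊔ K) = 11 := by
      rcases (Nat.Prime.eq_one_or_self_of_dvd (by norm_num) _ (Dvd.intro _ h1)) with h | h
      · rw [Subgroup.relIndex_eq_one] at h
        exact absurd h (not_le_of_gt hlt)
      · exact h
    rw [h2] at h1
    have h3 : K ⊔ N = ⊤ := by
      rw [sup_comm, ← Subgroup.index_eq_one]; omega
    have h4 : N.relIndex K = N.index := by
      rw [← Subgroup.relIndex_sup_right, h3, Subgroup.relIndex_top_right]
    have h5 := K.card_mul_index
    rw [← N.card_mul_index, hKi, ← Subgroup.card_mul_index (N.subgroupOf K)] at h5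
    have h6 : (N.subgroupOf K).index = N.index := h4
    rw [h6] at h5
    have h7 : 0 < N.index := Nat.pos_of_ne_zero Subgroup.index_ne_zero_of_finite
    exact ⟨Nat.card (N.subgroupOf K), Nat.eq_of_mul_eq_mul_right h7 (by rw [← h5]; ring)⟩
  have hci : Nat.card N * N.index = 7920 := by rw [Subgroup.card_mul_index, card_Γ]
  have hcop : Nat.Coprime N.index 11 := by
    apply Nat.Coprime.symm
    rw [Nat.Prime.coprime_iff_not_dvd (by norm_num)]
    rintro ⟨k, hk⟩
    obtain ⟨l, hl⟩ := h11
    rw [hk, hl] at hci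
    have : 121 ∣ 7920 := ⟨l * k, by rw [← hci]; ring⟩
    revert this; decide
  have key : ∀ x : Γ, x ^ 11 = 1 → x ∈ N := by
    intro x h11
    have hm := N.pow_index_mem x
    have hb := Nat.gcd_eq_gcd_ab N.index 11
    rw [hcop] at hb
    have : x = (x ^ N.index) ^ (N.index.gcdA 11) * (x ^ 11) ^ (N.index.gcdB 11) := by
      rw [← zpow_natCast, ← zpow_natCast, ← zpow_mul, ← zpow_mul, ← zpow_add, ← hb]; simp
    rw [this, h11, one_zpow, mul_one]
    exact zpow_mem hm _
  have h5 := low_aux (N.map Γ.subtype) ⟨⟨ss, ss_mem⟩, key _ (Subtype.ext ss_pow), rfl⟩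
    ⟨⟨uu, uu_mem⟩, key _ (Subtype.ext uu_pow), rfl⟩
  rw [Subgroup.card_map_of_injective Γ.subtype_injective] at h5
  apply Subgroup.eq_top_of_le_card
  rw [card_Γ]; exact h5

end M11

namespace M11

section lists
variable {S T : Type*} [CommRing S] [CommRing T]

/-- Evaluation of an integer coefficient list (low degree first). -/
def ev : List ℤ → S → S
  | [], _ => 0
  | c :: l, x => (c : S) + x * ev l x

def ev2 : List (List ℤ) → S → S → S
  | [], _, _ => 0
  | c :: l, X, x => ev c X + x * ev2 l X x

def addL : List ℤ → List ℤ → List ℤ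
  | [], b => b
  | a :: l, [] => a :: l
  | a :: l, b :: m => (a + b) :: addL l m

def smulL (c : ℤ) : List ℤ → List ℤ
  | [] => []
  | a :: l => (c * a) :: smulL c l

def mulL : List ℤ → List ℤ → List ℤ
  | [], _ => []
  | a :: l, b => addL (smulL a b) (0 :: mulL l b)

def allZ : List ℤ → Bool
  | [] => true
  | a :: l => decide (a = 0) && allZ l

def eqL (a b : List ℤ) : Bool := allZ (addL a (smulL (-1) b))

def add2 : List (List ℤ) → List (List ℤ) → List (List ℤ)
  | [], b => b
  | a :: l, [] => a :: l
  | a :: l, b :: m => addL a b :: add2 l m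

def smul2 (c : List ℤ) : List (List ℤ) → List (List ℤ)
  | [] => []
  | a :: l => mulL c a :: smul2 c l

def mul2 : List (List ℤ) → List (List ℤ) → List (List ℤ)
  | [], _ => []
  | a :: l, b => add2 (smul2 a b) ([] :: mul2 l b)

def allZ2 : List (List ℤ) → Bool
  | [] => true
  | a :: l => allZ a && allZ2 l

def eq2 (a b : List (List ℤ)) : Bool := allZ2 (add2 a (smul2 [-1] b))

theorem ev_addL (a b : List ℤ) (x : S) : ev (addL a b) x = ev a x + ev b x := by
  induction a generalizing b with
  | nil => simp [addL, ev]
  | cons a l ih =>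
    cases b with
    | nil => simp [addL, ev]
    | cons b m => simp [addL, ev, ih]; ring

theorem ev_smulL (c : ℤ) (a : List ℤ) (x : S) : ev (smulL c a) x = c * ev a x := by
  induction a with
  | nil => simp [smulL, ev]
  | cons a l ih => simp [smulL, ev, ih]; ring

theorem ev_mulL (a b : List ℤ) (x : S) : ev (mulL a b) x = ev a x * ev b x := by
  induction a with
  | nil => simp [mulL, ev]
  | cons a l ih => simp [mulL, ev, ev_addL, ev_smulL, ih]; ring

theorem ev_allZ (a : List ℤ) (h : allZ a = true) (x : S) : ev a x = 0 := by
  induction a with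
  | nil => rfl
  | cons a l ih =>
    simp [allZ] at h
    simp [ev, h.1, ih h.2]

theorem ev_eqL {a b : List ℤ} (h : eqL a b = true) (x : S) : ev a x = ev b x := by
  have := ev_allZ _ h x
  rw [ev_addL, ev_smulL] at this
  push_cast at this
  linear_combination this

theorem ev2_add2 (a b : List (List ℤ)) (X x : S) : ev2 (add2 a b) X x = ev2 a X x + ev2 b X x := by
  induction a generalizing b with
  | nil => simp [add2, ev2]
  | cons a l ih =>
    cases b with
    | nil => simp [add2, ev2]
    | cons b m => simp [add2, ev2, ev_addL, ih]; ring

theorem ev2_smul2 (c : List ℤ) (a : List (List ℤ)) (X x : S) :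
    ev2 (smul2 c a) X x = ev c X * ev2 a X x := by
  induction a with
  | nil => simp [smul2, ev2]
  | cons a l ih => simp [smul2, ev2, ev_mulL, ih]; ring

theorem ev2_mul2 (a b : List (List ℤ)) (X x : S) :
    ev2 (mul2 a b) X x = ev2 a X x * ev2 b X x := by
  induction a with
  | nil => simp [mul2, ev2]
  | cons a l ih => simp [mul2, ev2, ev2_add2, ev2_smul2, ih, ev]; ring

theorem ev2_allZ2 (a : List (List ℤ)) (h : allZ2 a = true) (X x : S) : ev2 a X x = 0 := by
  induction a with
  | nil => rfl
  | cons a l ih =>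
    simp [allZ2] at h
    simp [ev2, ev_allZ _ h.1, ih h.2]

theorem ev2_eq2 {a b : List (List ℤ)} (h : eq2 a b = true) (X x : S) : ev2 a X x = ev2 b X x := by
  have := ev2_allZ2 _ h X x
  rw [ev2_add2, ev2_smul2] at this
  simp [ev] at this
  linear_combination this

theorem map_ev (φ : S →+* T) (l : List ℤ) (x : S) : φ (ev l x) = ev l (φ x) := by
  induction l with
  | nil => simp [ev]
  | cons a l ih => simp [ev, ih]

theorem map_ev2 (φ : S →+* T) (l : List (List ℤ)) (X x : S) :
    φ (ev2 l X x) = ev2 l (φ X) (φ x) := by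
  induction l with
  | nil => simp [ev2]
  | cons a l ih => simp [ev2, ih, map_ev]

theorem ev_cast (l : List ℤ) (x : ℤ) : ev l (x : S) = ((ev l x : ℤ) : S) :=
  (map_ev (Int.castRingHom S) l x).symm

theorem ev2_cast (l : List (List ℤ)) (X x : ℤ) : ev2 l (X : S) (x : S) = ((ev2 l X x : ℤ) : S) :=
  (map_ev2 (Int.castRingHom S) l X x).symm

/-- Constant (in `X`) bivariate list. -/
def const2 : List ℤ → List (List ℤ)
  | [] => []
  | c :: l => [c] :: const2 l

theorem ev2_const2 (l : List ℤ) (X x : S) : ev2 (const2 l) X x = ev l x := by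
  induction l with
  | nil => rfl
  | cons a l ih => simp [const2, ev2, ev, ih]

noncomputable def toP (l : List ℤ) : S[X] := ev l X

theorem toP_eval₂ (ψ : S →+* T) (y : T) (l : List ℤ) : (toP l).eval₂ ψ y = ev l y := by
  have := map_ev (eval₂RingHom ψ y) l X
  simpa [toP] using this

theorem toP_map (ψ : S →+* T) (l : List ℤ) : (toP l).map ψ = toP l := by
  have := map_ev (mapRingHom ψ) l X
  simpa [toP] using this

theorem toP_degree (l : List ℤ) : (toP l : S[X]).degree < l.length := by
  induction l with
  | nil => simp [toP, ev]
  | cons a l ih =>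
    have h1 : (toP (a :: l) : S[X]) = C (a : S) + X * toP l := by simp [toP, ev]
    rw [h1]
    refine lt_of_le_of_lt (degree_add_le _ _) (max_lt ?_ ?_)
    · refine lt_of_le_of_lt degree_C_le ?_
      exact_mod_cast Nat.succ_pos _
    · refine lt_of_le_of_lt (degree_mul_le _ _) ?_
      refine lt_of_le_of_lt (add_le_add_left degree_X_le _) ?_
      rcases eq_or_ne (toP l : S[X]) 0 with h | h
      · rw [h]; simp
      · rw [degree_eq_natDegree h] at ih ⊢
        rw [List.length_cons]
        norm_cast at ih ⊢
        omega

/-! arithmetic modulo a prime and a monic list -/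

def normL (p : ℤ) : List ℤ → List ℤ
  | [] => []
  | a :: l => match normL p l with
    | [] => if a % p = 0 then [] else [a % p]
    | b :: m => (a % p) :: b :: m

theorem emod_cast (p : ℤ) (hp : (p : S) = 0) (a : ℤ) : ((a % p : ℤ) : S) = a := by
  have := Int.emod_add_mul_ediv a p
  have h := congrArg (Int.cast : ℤ → S) this
  push_cast at h
  rw [hp, zero_mul, add_zero] at h
  exact h

theorem ev_normL (p : ℤ) (hp : (p : S) = 0) (l : List ℤ) (x : S) :
    ev (normL p l) x = ev l x := by
  induction l with
  | nil => rfl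
  | cons a l ih =>
    rw [normL]
    split
    · rename_i h
      rw [h] at ih
      simp only [ev] at ih ⊢
      rw [← ih]
      split
      · rename_i h2
        have := emod_cast (S := S) p hp a
        rw [h2] at this
        simp [ev, ← this]
      · simp [ev, emod_cast p hp]
    · rename_i b m h
      rw [h] at ih
      rw [ev, ih, emod_cast p hp, ev]

def mulX (p : ℤ) (g : List ℤ) (a : List ℤ) : List ℤ :=
  normL p (addL (0 :: a) (smulL (-((0 :: a).getD (g.length - 1) 0)) g))

def mulM (p : ℤ) (g : List ℤ) : List ℤ → List ℤ → List ℤ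
  | [], _ => []
  | a :: l, b => normL p (addL (smulL a b) (mulX p g (mulM p g l b)))

def powM (p : ℤ) (g : List ℤ) (a : List ℤ) : ℕ → List ℤ
  | 0 => [1]
  | n + 1 => mulM p g a (powM p g a n)

def frobM (p : ℕ) (g : List ℤ) : ℕ → List ℤ
  | 0 => [0, 1]
  | n + 1 => powM p g (frobM p g n) p

variable {p : ℕ} {g : List ℤ} {y : S}

theorem ev_mulX (hp : ((p : ℤ) : S) = 0) (hg : ev g y = 0) (a : List ℤ) :
    ev (mulX p g a) y = y * ev a y := by
  rw [mulX, ev_normL _ hp, ev_addL, ev_smulL, hg]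
  simp [ev]

theorem ev_mulM (hp : ((p : ℤ) : S) = 0) (hg : ev g y = 0) (a b : List ℤ) :
    ev (mulM p g a b) y = ev a y * ev b y := by
  induction a with
  | nil => simp [mulM, ev]
  | cons a l ih =>
    rw [mulM, ev_normL _ hp, ev_addL, ev_smulL, ev_mulX hp hg, ih, ev]; ring

theorem ev_powM (hp : ((p : ℤ) : S) = 0) (hg : ev g y = 0) (a : List ℤ) (n : ℕ) :
    ev (powM p g a n) y = ev a y ^ n := by
  induction n with
  | zero => simp [powM, ev]
  | succ n ih => rw [powM, ev_mulM hp hg, ih, pow_succ']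

theorem ev_frobM (hp : ((p : ℤ) : S) = 0) (hg : ev g y = 0) (n : ℕ) :
    ev (frobM p g n) y = (fun z => z ^ p)^[n] y := by
  induction n with
  | zero => simp [frobM, ev]
  | succ n ih => rw [frobM, ev_powM hp hg, ih, Function.iterate_succ_apply']

end lists

theorem exists_root_list {κ : Type*} [Field κ] [IsAlgClosed κ] (l : List ℤ) (hl : l ≠ []) :
    ∃ y : κ, ev (l ++ [1]) y = 0 := by
  have h1 : ∀ l : List ℤ, ∀ y : κ, ev (l ++ [1]) y = ev l y + y ^ l.length := by
    intro l y
    induction l with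
    | nil => simp [ev]
    | cons a l ih => simp [ev, ih]; ring
  have hd : (toP l : κ[X]).degree < (l.length : ℕ) := toP_degree l
  have hdeg : (X ^ l.length + toP l : κ[X]).degree ≠ 0 := by
    rw [degree_add_eq_left_of_degree_lt (by rw [degree_X_pow]; exact hd), degree_X_pow]
    have := List.length_pos_iff.2 hl
    norm_cast
    omega
  obtain ⟨y, hy⟩ := IsAlgClosed.exists_root _ hdeg
  refine ⟨y, ?_⟩
  have h2 := toP_eval₂ (RingHom.id κ) y l
  rw [eval₂_id] at h2
  rw [h1, ← h2]
  simp [IsRoot] at hy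
  linear_combination hy

/-- If `y` is a root of `g`, Frobenius certificates force the period. -/
theorem period_of_cert {κ : Type*} [Field κ] (p : ℕ) [CharP κ p] (g iv : List ℤ) (ℓ k : ℕ)
    (hℓ : ℓ.Prime)
    (h1 : eqL (frobM p g (ℓ ^ (k + 1))) [0, 1] = true)
    (h2 : eqL (mulM p g (addL (frobM p g (ℓ ^ k)) [0, -1]) iv) [1] = true)
    (y : κ) (hy : ev g y = 0) (N : ℕ) (hN : (fun z => z ^ p)^[N] y = y) : ℓ ^ (k + 1) ∣ N := by
  have hp : ((p : ℤ) : κ) = 0 := by simp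
  have a1 : Function.IsPeriodicPt (fun z : κ => z ^ p) (ℓ ^ (k + 1)) y := by
    rw [Function.IsPeriodicPt, Function.IsFixedPt, ← ev_frobM hp hy, ev_eqL h1]
    simp [ev]
  have a2 : ¬ Function.IsPeriodicPt (fun z : κ => z ^ p) (ℓ ^ k) y := by
    intro h
    rw [Function.IsPeriodicPt, Function.IsFixedPt, ← ev_frobM hp hy] at h
    have h3 := ev_eqL h2 y
    rw [ev_mulM hp hy, ev_addL, h] at h3
    simp [ev] at h3
  have := Fact.mk hℓ
  rw [← Function.minimalPeriod_eq_prime_pow a2 a1]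
  exact Function.IsPeriodicPt.minimalPeriod_dvd hN

end M11

namespace M11


theorem lift_root {R L κ : Type*} [CommRing R] [Field L] [Algebra R L] [Field κ]
    (F : R[X]) (hs : (F.map (algebraMap R L)).Splits) (hm : F.Monic)
    (φ : integralClosure R L →+* κ) (y : κ)
    (hy : F.eval₂ (φ.comp (algebraMap R _)) y = 0) :
    ∃ b : integralClosure R L, F.eval₂ (algebraMap R _) b = 0 ∧ φ b = y := by
  have hint : ∀ r ∈ (F.map (algebraMap R L)).roots, r ∈ (integralClosure R L) := by
    intro r hr
    refine ⟨F, hm, ?_⟩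
    have := (mem_roots'.1 hr).2
    rwa [IsRoot, eval_map] at this
  have hprod := hs.eq_prod_roots_of_monic (hm.map _)
  set s := (F.map (algebraMap R L)).roots with hsdef
  have key : F.map (algebraMap R (integralClosure R L)) = (s.attach.map fun r => X - C (⟨r.1, hint r.1 r.2⟩ : (integralClosure R L))).prod := by
    apply Polynomial.map_injective (algebraMap (integralClosure R L) L) Subtype.val_injective
    rw [Polynomial.map_map, ← IsScalarTower.algebraMap_eq, Polynomial.map_multiset_prod,
      Multiset.map_map, hprod]
    congr 1
    conv_lhs => rw [← Multiset.attach_map_val s, Multiset.map_map]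
    apply Multiset.map_congr rfl
    intro r _
    simp
  have h2 : ((F.map (algebraMap R (integralClosure R L))).map φ).eval y = 0 := by
    rw [Polynomial.map_map, eval_map]; exact hy
  rw [key, Polynomial.map_multiset_prod, eval_multiset_prod, Multiset.prod_eq_zero_iff,
    Multiset.map_map, Multiset.map_map, Multiset.mem_map] at h2
  obtain ⟨r, -, hr⟩ := h2
  refine ⟨⟨r.1, hint r.1 r.2⟩, ?_, ?_⟩
  · apply Subtype.val_injective
    have h3 := (mem_roots'.1 r.2).2
    rw [IsRoot, eval_map] at h3
    change (algebraMap (integralClosure R L) L) _ = 0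
    rw [Polynomial.hom_eval₂, ← IsScalarTower.algebraMap_eq]
    exact h3
  · simp at hr
    exact (sub_eq_zero.1 hr).symm

/-- the specialization ideal -/
noncomputable def spec (p : ℕ) (t0 : ℤ) : ℤ[X] →+* ZMod p := eval₂RingHom (Int.castRingHom _) (t0 : ZMod p)

theorem spec_surj (p : ℕ) (t0 : ℤ) : Function.Surjective (spec p t0) := by
  intro z
  obtain ⟨k, rfl⟩ := ZMod.intCast_surjective z
  exact ⟨C k, by simp [spec]⟩

theorem spec_max (p : ℕ) [Fact p.Prime] (t0 : ℤ) : (RingHom.ker (spec p t0)).IsMaximal :=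
  RingHom.ker_isMaximal_of_surjective _ (spec_surj p t0)

theorem exists_place {L : Type*} [Field L] [Algebra ℤ[X] L]
    (hinj : Function.Injective (algebraMap ℤ[X] L)) (p : ℕ) [hp : Fact p.Prime] (t0 : ℤ) :
    ∃ Q : Ideal (integralClosure ℤ[X] L), Q.IsMaximal ∧
      Q.comap (algebraMap ℤ[X] _) = RingHom.ker (spec p t0) := by
  have := spec_max p t0
  apply Ideal.exists_ideal_over_maximal_of_isIntegral
  intro x hx
  rw [RingHom.mem_ker] at hx
  have h2 : algebraMap ℤ[X] L x = 0 := by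
    have := congrArg (algebraMap (integralClosure ℤ[X] L) L) hx
    rwa [← IsScalarTower.algebraMap_apply, map_zero] at this
  have : x = 0 := hinj (by rw [h2, map_zero])
  rw [this]; exact zero_mem _

theorem place_props {L : Type*} [Field L] [Algebra ℤ[X] L]
    (p : ℕ) [hp : Fact p.Prime] (t0 : ℤ) (Q : Ideal (integralClosure ℤ[X] L)) [Q.IsMaximal]
    (hQ : Q.comap (algebraMap ℤ[X] _) = RingHom.ker (spec p t0)) :
    Ideal.Quotient.mk Q (algebraMap ℤ[X] _ X) = ((t0 : ℤ) : (integralClosure ℤ[X] L) ⧸ Q) ∧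
    CharP ((integralClosure ℤ[X] L) ⧸ Q) p := by
  have hm : ∀ x : ℤ[X], spec p t0 x = 0 → Ideal.Quotient.mk Q (algebraMap ℤ[X] _ x) = 0 := by
    intro x hx
    rw [Ideal.Quotient.eq_zero_iff_mem]
    have : x ∈ Q.comap (algebraMap ℤ[X] _) := by rw [hQ]; exact hx
    exact this
  constructor
  · have := hm (X - C t0) (by simp [spec])
    rw [map_sub, map_sub, sub_eq_zero] at this
    rw [this]
    simp
  · have h1 : ((p : ℕ) : (integralClosure ℤ[X] L) ⧸ Q) = 0 := by
      have := hm (C (p : ℤ)) (by simp [spec])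
      simpa using this
    exact (CharP.charP_iff_prime_eq_zero hp.out).2 h1

theorem frob_exists {K L : Type} [Field K] [Field L] [Algebra ℤ[X] K] [IsFractionRing ℤ[X] K]
    [Algebra K L] [Algebra ℤ[X] L] [IsScalarTower ℤ[X] K L] [FiniteDimensional K L] [IsGalois K L]
    (p : ℕ) [hp : Fact p.Prime] (t0 : ℤ) :
    ∃ (κ : Type) (_ : Field κ) (_ : IsAlgClosed κ) (_ : CharP κ p)
      (φ : integralClosure ℤ[X] L →+* κ) (σ : L ≃ₐ[K] L),
      φ (algebraMap ℤ[X] _ X) = (t0 : κ) ∧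
      ∀ b b' : integralClosure ℤ[X] L, (b' : L) = σ b → φ b' = φ b ^ p := by
  have hinj : Function.Injective (algebraMap ℤ[X] L) := by
    rw [IsScalarTower.algebraMap_eq ℤ[X] K L]
    exact (algebraMap K L).injective.comp (IsFractionRing.injective ℤ[X] K)
  obtain ⟨Q, hQm, hQ⟩ := exists_place hinj p t0
  obtain ⟨h1, h2⟩ := place_props p t0 Q hQ
  let : Field ((integralClosure ℤ[X] L) ⧸ Q) := Ideal.Quotient.field Q
  let := IsIntegralClosure.MulSemiringAction ℤ[X] K L (integralClosure ℤ[X] L)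
  have hfr : IsFractionRing (integralClosure ℤ[X] L) L := integralClosure.isFractionRing_of_finite_extension K L
  have hinv : Algebra.IsInvariant ℤ[X] (integralClosure ℤ[X] L) (L ≃ₐ[K] L) := Algebra.isInvariant_of_isGalois ℤ[X] K L (integralClosure ℤ[X] L)
  have hfin : Module.Finite ℤ[X] (integralClosure ℤ[X] L) := IsIntegralClosure.finite ℤ[X] K L (integralClosure ℤ[X] L)
  have hund : Q.under ℤ[X] = RingHom.ker (spec p t0) := hQ
  have hequiv : (ℤ[X] ⧸ Q.under ℤ[X]) ≃+* ZMod p :=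
    (Ideal.quotEquivOfEq hund).trans (RingHom.quotientKerEquivOfSurjective (spec_surj p t0))
  have hcard : Nat.card (ℤ[X] ⧸ Q.under ℤ[X]) = p := by
    rw [Nat.card_congr hequiv.toEquiv, Nat.card_zmod]
  have hf1 : Finite (ℤ[X] ⧸ Q.under ℤ[X]) := Nat.finite_of_card_ne_zero (by rw [hcard]; exact hp.out.ne_zero)
  have hf2 : Module.Finite (ℤ[X] ⧸ Q.under ℤ[X]) ((integralClosure ℤ[X] L) ⧸ Q) := inferInstance
  have hf3 : Finite ((integralClosure ℤ[X] L) ⧸ Q) := Module.finite_of_finite (ℤ[X] ⧸ Q.under ℤ[X])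
  have hc : SMulCommClass (L ≃ₐ[K] L) ℤ[X] (integralClosure ℤ[X] L) := by
    constructor
    intro s r b
    change galRestrict ℤ[X] K L (integralClosure ℤ[X] L) s (r • b) = r • galRestrict ℤ[X] K L (integralClosure ℤ[X] L) s b
    rw [map_smul]
  obtain ⟨σ, hσ⟩ := IsArithFrobAt.exists_of_isInvariant ℤ[X] (L ≃ₐ[K] L) Q
  refine ⟨AlgebraicClosure ((integralClosure ℤ[X] L) ⧸ Q), inferInstance, inferInstance,
    charP_of_injective_algebraMap (algebraMap ((integralClosure ℤ[X] L) ⧸ Q) (AlgebraicClosure ((integralClosure ℤ[X] L) ⧸ Q))).injective p,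
    (algebraMap ((integralClosure ℤ[X] L) ⧸ Q) (AlgebraicClosure ((integralClosure ℤ[X] L) ⧸ Q))).comp (Ideal.Quotient.mk Q), σ, ?_, ?_⟩
  · rw [RingHom.comp_apply, h1, map_intCast]
  · intro b b' hb
    have h3 := hσ b
    rw [hcard, ← Ideal.Quotient.eq, map_pow] at h3
    have h4 : b' = galRestrict ℤ[X] K L (integralClosure ℤ[X] L) σ b := by
      apply Subtype.val_injective
      rw [hb]
      exact (algebraMap_galRestrict_apply ℤ[X] σ b).symm
    rw [RingHom.comp_apply, RingHom.comp_apply, ← map_pow, ← h3, h4]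
    rfl

end M11

namespace M11

def pc0 : List ℤ := [-1088,-6912,-20544,-16512,7728,-1920,9056,4032,2676,912,204,24]
def pcL : List ℤ := [-1088,-6912,-20544,-16512,7728,-1920,9056,4032,2676,912,204,24,1]
def qcL : List ℤ := mulL (mulL [-2,0,1] (mulL [-2,0,1] [-2,0,1])) [2,6,3,1]

noncomputable def F12 : Polynomial (Polynomial ℤ) :=
  X ^ 12 + ((toP pc0 : Polynomial (Polynomial ℤ)) - C (X : Polynomial ℤ) * (toP qcL : Polynomial (Polynomial ℤ)))

theorem F12_monic : F12.Monic := by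
  apply monic_X_pow_add
  refine lt_of_le_of_lt (degree_sub_le _ _) (max_lt ?_ ?_)
  · exact toP_degree pc0
  · refine lt_of_le_of_lt (degree_mul_le _ _) ?_
    refine lt_of_le_of_lt (add_le_add_left degree_C_le _) ?_
    rw [zero_add]
    refine lt_trans (toP_degree qcL) ?_
    have : qcL.length = 10 := by decide +kernel
    rw [this]; norm_num

theorem F12_eval {S : Type*} [CommRing S] (ψ : ℤ[X] →+* S) (y : S) :
    F12.eval₂ ψ y = ev pcL y - ψ X * ev qcL y := by
  simp only [F12, eval₂_add, eval₂_sub, eval₂_mul, eval₂_X_pow, eval₂_C, toP_eval₂]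
  simp [pc0, pcL, ev]
  ring

theorem eval_zero_of_cert {κ : Type*} [Field κ] (p : ℕ) [CharP κ p] (t0 : ℤ) (g cof : List ℤ)
    (h : normL p (addL (mulL g cof) (smulL (-1) (addL pcL (smulL (-t0) qcL)))) = [])
    (y : κ) (hy : ev g y = 0) : ev pcL y - (t0 : κ) * ev qcL y = 0 := by
  have hp : ((p : ℤ) : κ) = 0 := by simp
  have h2 := ev_normL (p : ℤ) hp (addL (mulL g cof) (smulL (-1) (addL pcL (smulL (-t0) qcL)))) y
  rw [h, ev_addL, ev_mulL, hy, ev_smulL, ev_addL, ev_smulL] at h2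
  simp [ev] at h2
  linear_combination h2

theorem frob_dvd {K L : Type} [Field K] [Field L] [Algebra ℤ[X] K] [IsFractionRing ℤ[X] K]
    [Algebra K L] [Algebra ℤ[X] L] [IsScalarTower ℤ[X] K L] [FiniteDimensional K L] [IsGalois K L]
    (hs : (F12.map (algebraMap ℤ[X] L)).Splits)
    (p : ℕ) [hp : Fact p.Prime] (t0 : ℤ) (l cof iv : List ℤ) (ℓ k : ℕ) (hl : l ≠ [])
    (hℓ : ℓ.Prime)
    (h0 : normL p (addL (mulL (l ++ [1]) cof) (smulL (-1) (addL pcL (smulL (-t0) qcL)))) = [])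
    (h1 : eqL (frobM p (l ++ [1]) (ℓ ^ (k + 1))) [0, 1] = true)
    (h2 : eqL (mulM p (l ++ [1]) (addL (frobM p (l ++ [1]) (ℓ ^ k)) [0, -1]) iv) [1] = true) :
    ℓ ^ (k + 1) ∣ Nat.card (L ≃ₐ[K] L) := by
  obtain ⟨κ, _, _, _, φ, σ, hX, hφ⟩ := frob_exists (K := K) (L := L) p t0
  obtain ⟨y, hy⟩ := exists_root_list (κ := κ) l hl
  obtain ⟨b, -, hb⟩ := lift_root F12 hs F12_monic φ y (by
    rw [F12_eval, RingHom.comp_apply, hX]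
    exact eval_zero_of_cert p t0 _ cof h0 y hy)
  have key : ∀ n : ℕ, ∀ b' : integralClosure ℤ[X] L, (b' : L) = (σ ^ n) b →
      φ b' = (fun z => z ^ p)^[n] y := by
    intro n
    induction n with
    | zero =>
      intro b' h
      have : b' = b := Subtype.val_injective h
      rw [this, hb]; rfl
    | succ n ih =>
      intro b' h
      have hi : (σ ^ n) (b : L) ∈ integralClosure ℤ[X] L :=
        IsIntegral.map ((σ ^ n).toAlgHom.restrictScalars ℤ[X]) b.2
      rw [hφ ⟨_, hi⟩ b' (by rw [h, pow_succ']; rfl), ih ⟨_, hi⟩ rfl,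
        Function.iterate_succ_apply']
  refine period_of_cert p (l ++ [1]) iv ℓ k hℓ h1 h2 y hy _ ?_
  rw [← key (Nat.card (L ≃ₐ[K] L)) b (by rw [pow_card_eq_one']; rfl), hb]

theorem dvd1320 {K L : Type} [Field K] [Field L] [Algebra ℤ[X] K] [IsFractionRing ℤ[X] K]
    [Algebra K L] [Algebra ℤ[X] L] [IsScalarTower ℤ[X] K L] [FiniteDimensional K L] [IsGalois K L]
    (hs : (F12.map (algebraMap ℤ[X] L)).Splits) : 1320 ∣ Nat.card (L ≃ₐ[K] L) := by
  have := Fact.mk (show Nat.Prime 5 by norm_num)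
  have := Fact.mk (show Nat.Prime 11 by norm_num)
  have e8 := frob_dvd (K := K) hs 5 0 [2, 4, 0, 2, 2, 4, 0, 4] [1, 2, 4, 0, 1]
    [0, 0, 2, 2, 2, 2, 4] 2 2 (by decide) (by norm_num)
    (by decide +kernel) (by decide +kernel) (by decide +kernel)
  have e11 := frob_dvd (K := K) hs 5 3 [2, 1, 1, 1, 2, 4, 2, 2, 4, 4, 4] [0, 1]
    [0, 3, 3, 0, 2, 3, 1, 2, 4, 4] 11 0 (by decide) (by norm_num)
    (by decide +kernel) (by decide +kernel) (by decide +kernel)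
  have e3 := frob_dvd (K := K) hs 5 4 [4, 3, 3, 0, 2, 0] [4, 2, 2, 0, 2, 4, 1]
    [4, 3, 4, 1, 1, 2] 3 0 (by decide) (by norm_num)
    (by decide +kernel) (by decide +kernel) (by decide +kernel)
  have e5 := frob_dvd (K := K) hs 11 1 [6, 2, 6, 1, 2, 3, 7, 9, 7, 6] [1, 7, 1]
    [5, 4, 7, 9, 3, 5, 8, 4, 6, 7] 5 0 (by decide) (by norm_num)
    (by decide +kernel) (by decide +kernel) (by decide +kernel)
  generalize Nat.card (L ≃ₐ[K] L) = N at *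
  norm_num at e8 e11 e3 e5
  omega

end M11

namespace M11

def sA : List (List ℤ) := [[0, 26233978572032, -1569276035136, -960937557408, -50756312496,
  1128179304, -13342320, -1045308, 52740, -108, -4], [390443369396736, 174268571942784,
  8942063954688, -1533081046176, -89879138928, 5654058624, 18941004, -5177412, 82494, 192, -6],
  [1171330108190208, 246326837760768, 17223908196384, 318205960272, -28442697768, 1727916732,
  95183856, -3029364, -50814, 1332, -6], [650738948994560, 65584946430080, -2937877385472,
  23138876832, 48270161760, -1534858416, -16688316, 804840, -36261, 434, -1], [390443369396736,
  126485253829440, 5216538431376, -689194090584, -9242107236, 167136102, 2973060, 435969, -18522,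
  147], [97610842349184, 21080875638240, -389308888512, -125471584008, -4791602484, 118911528,
  7700931, 40167, -3339, 21], [32536947449728, 6132618367488, 209203358904, -5284345812,
  -324165582, 7900929, 469632, 1098, -162, 1]]
def sB : List (List ℤ) := [[-170350510208, -29655258976, -2879956064, 212297264, -13094012,
  -1155532, 11434, -64, -2], [-511051530624, -137127701280, -13604202672, 842717976, 4189260,
  -2187444, 45318, 240, -6], [-511051530624, -198667937952, -13938660480, 317707872, 43616952,
  -358440, -17475, 558, -3], [-851752551040, -116168345312, 11073296816, 159753928, -3925864,
  466216, -18133, 310, -1], [-383288647968, -38629876824, 2497927032, 112635756, -12741525, 43281,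
  -3015, 63], [-127762882656, -4849638216, -896994828, -49412082, -1154631, -1881, -141, 3], []]
def uA : List (List ℤ) := [[-8329458547130368, 294365681639424, 188152584468480, 4881136786944,
  -81548259840, -9025434432, -531479712, 13170384, -28152, -616], [-12494187820695552,
  -523316767358976, 294301465740288, 24176277398016, 115767416448, -45232468992, -941142816,
  21012048, 160416, -4092, 12], [-12494187820695552, -3630510073552896, -181281483260928,
  14145821194752, 581763727872, -13823333856, -297829296, -4361256, 308988, -5784, 36],
  [-2082364636782592, -1182913942884352, -129362928809472, -3758255109120, -101998987392,
  12278867328, 505446720, -317136, -52704, -1540, 20], [0, -400664400009216, -66078160210944,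
  -2035786891392, 18171342720, -1337088816, -96775992, 9445932, 93582, -2970, 12], [0,
  -57237771429888, -11912049289728, -187562537856, 47068090272, -951292224, -50173848, 1719684,
  -6984, -495, 3], [0, -2725608163328, -577943092224, -5127185664, 2870390784, -63207432,
  -3394404, 72426, 3753, -144, 1]]
def uB : List (List ℤ) := [[-5451216326656, 228323196928, 53391840512, 7062611584, -104752096,
  -2223008, -39472, 532, -4], [-16353648979968, -856211988480, 211615482624, 13369657728,
  33514080, -8824272, -186456, 2460, -12], [-8176824489984, -1990692873216, -81600700800,
  2190785280, 348935616, -3326784, -191040, 3564, -12], [-2725608163328, -1105940485120,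
  -84673276544, -2849512192, -31406912, -1672816, 151768, 2084, -20], [0, -224755646976,
  -14078747520, -264533472, -101932200, -1179432, 34236, 693, -9], [0, -10702649856, -658409088,
  11496672, -9237048, 517404, -12294, 87, -3], []]
def lq : List ℤ := [1167392, 103904, -6576, -136, 2]
def ln : List ℤ := [67753788758167129797585534976, -4700197387673897747738263552,
  -712365686262834892765724672, 93599081470319123510771712, -51929922198442064133046272,
  -11899654957447317183664128, -669716173892986902054912, -4827325646248819616256,
  -970957250521863218688, 78383442591441165440, 6465757444861990912, -102596129046388960,
  -1663463944453728, 10824965505624, -1965700522632, 45715931772, -261130452, -616053, -6137, 53,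
  1]
def le : List ℤ := [88682969578752787693174784, 3366238374062605815578624,
  -140538476981761616691200, -171665154434234108563456, -21399908504403632205824,
  -2953943716779203147776, -645629815325497860608, -27981540482058245248, 691480310581825792, 0,
  905078940552128, 47938551030088, -1447783098232, 8670193336, -82213876, 863221, -925, -29, 1]
def la : List ℤ := [-88682969578752787693174784, -35519618705626116536795136,
  -4281333776074660104585216, -44553898942965717565440, 18411409403314585242624,
  295333034728093189632, -51035670987280423104, -1055243325052737216, 91986867651124080,
  1586106482006432, -120401659229220, -1807864581996, 114444190941, 866839302, -70732701, -224040,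
  28179, -306, 1]
def lm : List ℤ := [-51763894611239687165355348721664, -3523197015424690749474447818752,
  3133346681156493494775251468288, -354835883473051154042035634176, -242845626352847947835113472,
  12141814603420154634287185920, -1218723664451151345896521728, 64647777945583182317027328,
  11123695354800263079088128, 1711902574961327531798528, 19013054011825339067392,
  -203164985304734406656, -24886196350556726528, 2932866723365120768, -24944167295685312,
  189749293579008, 4682075916672, 61055310720, 1598368, -3056896, -35332, -52]
def ld : List ℤ := 0 :: la
def cc : Fin 12 → ℤ := ![27, 33, 72, 73, 86, 129, 269, 293, 347, 409, 478, 495]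
def xx : Fin 22 → ℤ := ![12, 131, 133, 147, 160, 173, 199, 215, 228, 259, 301, 336, 342, 345, 348,
  355, 421, 452, 459, 492, 494, 541]
def ww : Fin 22 → ℤ := ![371, 270, 264, 447, 127, 249, 260, 267, 432, 72, 221, 44, 67, 144, 260,
  81, 290, 49, 150, 225, 499, 423]

theorem id1 : eq2 (add2 (mul2 sA uA) (smul2 lq (mul2 sB uB)))
    (add2 (smul2 ld (const2 pcL)) (smul2 (smulL (-1) ln) (const2 qcL))) = true := by
  decide +kernel

theorem id2 : eq2 (add2 (mul2 sA uB) (mul2 uA sB)) (smul2 (smulL (-1) le) (const2 qcL)) = true := by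
  decide +kernel

theorem id3 : eqL (addL (mulL ln ln) (smulL (-1) (mulL lq (mulL le le))))
    (mulL la (smulL (-1) (lm ++ [1]))) = true := by
  decide +kernel

/-- the degree 22 resolvent, specialized at `t = 310` -/
def l22 : List ℤ :=
  addL (lm ++ [1]) (addL (smulL (2 * 310) (0 :: ln)) (smulL (-(310 * 310)) (0 :: 0 :: la)))

def prodL : List ℤ → List ℤ
  | [] => [1]
  | a :: l => mulL [-a, 1] (prodL l)

theorem id4 : normL 547 (addL l22 (smulL (-1) (prodL (List.ofFn xx)))) = [] := by
  decide +kernel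

theorem chk_root : ∀ i : Fin 12, (ev pcL (cc i) - 310 * ev qcL (cc i)) % 547 = 0 := by
  decide +kernel

theorem chk_le : ∀ j : Fin 22, ev le (xx j) % 547 ≠ 0 := by decide +kernel

theorem chk_w : ∀ j : Fin 22,
    (310 * ev ld (xx j) - ev ln (xx j) - ev le (xx j) * ww j) % 547 = 0 := by decide +kernel

theorem chk_inc : ∀ j : Fin 22, ∀ i : Fin 12,
    if inc j i then (ev2 uA (xx j) (cc i) + ww j * ev2 uB (xx j) (cc i)) % 547 ≠ 0
    else (ev2 sA (xx j) (cc i) + ww j * ev2 sB (xx j) (cc i)) % 547 ≠ 0 := by decide +kernel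

theorem cc_inj : ∀ i j : Fin 12, (cc i - cc j) % 547 = 0 → i = j := by decide +kernel

noncomputable def F22 : Polynomial (Polynomial ℤ) :=
  X ^ 22 + ((toP lm : Polynomial (Polynomial ℤ)) +
    (C (X : Polynomial ℤ) * (toP (smulL 2 (0 :: ln)) : Polynomial (Polynomial ℤ)) -
     C ((X : Polynomial ℤ) ^ 2) * (toP (0 :: 0 :: la) : Polynomial (Polynomial ℤ))))

theorem deg_aux (a : ℤ[X]) (l : List ℤ) (hl : l.length ≤ 22) :
    (C a * (toP l : Polynomial (Polynomial ℤ))).degree < ((22 : ℕ) : WithBot ℕ) := by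
  refine lt_of_le_of_lt (degree_mul_le _ _) ?_
  refine lt_of_le_of_lt (add_le_add_left degree_C_le _) ?_
  rw [zero_add]
  refine lt_of_lt_of_le (toP_degree l) ?_
  exact_mod_cast hl

theorem F22_monic : F22.Monic := by
  apply monic_X_pow_add
  refine lt_of_le_of_lt (degree_add_le _ _) (max_lt ?_ ?_)
  · exact toP_degree lm
  · refine lt_of_le_of_lt (degree_sub_le _ _) (max_lt ?_ ?_)
    · exact deg_aux _ _ (by decide +kernel)
    · exact deg_aux _ _ (by decide +kernel)

theorem ev_append {S : Type*} [CommRing S] (l : List ℤ) (y : S) :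
    ev (l ++ [1]) y = ev l y + y ^ l.length := by
  induction l with
  | nil => simp [ev]
  | cons a l ih => simp [ev, ih]; ring

theorem ev_cons {S : Type*} [CommRing S] (l : List ℤ) (y : S) (a : ℤ) :
    ev (a :: l) y = a + y * ev l y := rfl

theorem F22_eval {S : Type*} [CommRing S] (ψ : ℤ[X] →+* S) (y : S) :
    F22.eval₂ ψ y = ev (lm ++ [1]) y + 2 * ψ X * (y * ev ln y) - ψ X ^ 2 * (y * (y * ev la y)) := by
  have h : lm.length = 22 := by decide +kernel
  have hC : ∀ a : ℤ[X], ∀ q : Polynomial (Polynomial ℤ),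
      (C a * q).eval₂ ψ y = ψ a * q.eval₂ ψ y := fun a q => by rw [eval₂_mul, eval₂_C]
  simp only [F22, eval₂_add, eval₂_sub, hC, eval₂_X_pow, toP_eval₂, ev_append, h,
    ev_smulL, ev_cons]
  rw [map_pow]
  push_cast
  ring

theorem ev_prodL {S : Type*} [CommRing S] [IsDomain S] (l : List ℤ) (y : S)
    (h : ev (prodL l) y = 0) : ∃ a ∈ l, y = (a : S) := by
  induction l with
  | nil => simp [prodL, ev] at h
  | cons a l ih =>
    rw [prodL, ev_mulL, mul_eq_zero] at h
    rcases h with h | h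
    · refine ⟨a, by simp, ?_⟩
      simp [ev] at h
      linear_combination h
    · obtain ⟨b, hb, h⟩ := ih h
      exact ⟨b, by simp [hb], h⟩

section pts
variable {B κ : Type*} [CommRing B] [Field κ] [CharP κ 547]

theorem z547 (a : ℤ) : (a : κ) = 0 ↔ a % 547 = 0 := by
  rw [CharP.intCast_eq_zero_iff κ 547]
  exact ⟨Int.emod_eq_zero_of_dvd, Int.dvd_of_emod_eq_zero⟩

/-- points of the auxiliary curve -/
def IsPt (τ x w : B) : Prop :=
  ev (lm ++ [1]) x + 2 * τ * (x * ev ln x) - τ ^ 2 * (x * (x * ev la x)) = 0 ∧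
  w ^ 2 = ev lq x ∧ τ * ev ld x = ev ln x + ev le x * w

def Sv (x w r : B) : B := ev2 sA x r + w * ev2 sB x r
def Uv (x w r : B) : B := ev2 uA x r + w * ev2 uB x r


theorem Sv_mul {τ x w r : B} (h : IsPt τ x w) (hr : ev pcL r - τ * ev qcL r = 0) :
    Sv x w r * Uv x w r = 0 := by
  obtain ⟨-, h2, h3⟩ := h
  have a1 := ev2_eq2 id1 x r
  have a2 := ev2_eq2 id2 x r
  simp only [ev2_add2, ev2_mul2, ev2_smul2, ev2_const2, ev_smulL] at a1 a2
  push_cast at a1 a2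
  rw [Sv, Uv]
  linear_combination a1 + w * a2 + ev2 sB x r * ev2 uB x r * h2 + ev qcL r * h3 +
    ev ld x * hr

theorem pt_red (φ : B →+* κ) {τ x w : B} (hτ : φ τ = ((310 : ℤ) : κ)) (h : IsPt τ x w) :
    ∃ j, φ x = (xx j : κ) ∧ φ w = (ww j : κ) := by
  obtain ⟨h1, h2, h3⟩ := h
  have a1 := congrArg φ h1
  have a3 := congrArg φ h3
  simp only [map_add, map_sub, map_mul, map_pow, map_ev, hτ, map_zero, map_ofNat] at a1 a3
  have p0 : ((547 : ℤ) : κ) = 0 := (z547 547).2 rfl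
  have a4 := ev_normL (547 : ℤ) p0 (addL l22 (smulL (-1) (prodL (List.ofFn xx)))) (φ x)
  rw [id4, ev_addL, ev_smulL] at a4
  have a5 : ev l22 (φ x) = 0 := by
    rw [l22]
    simp only [ev_addL, ev_smulL, ev_cons]
    push_cast at a1 ⊢
    linear_combination a1
  rw [a5] at a4
  obtain ⟨a, ha, hx⟩ := ev_prodL (List.ofFn xx) (φ x) (by
    simp [ev] at a4; exact a4)
  rw [List.mem_ofFn] at ha
  obtain ⟨j, rfl⟩ := ha
  refine ⟨j, hx, ?_⟩
  rw [hx, ev_cast, ev_cast, ev_cast] at a3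
  have b1 : ((ev le (xx j) : ℤ) : κ) ≠ 0 := fun h => chk_le j ((z547 _).1 h)
  have b2 := (z547 (κ := κ) _).2 (chk_w j)
  push_cast at b2 a3
  apply mul_left_cancel₀ b1
  linear_combination b2 - a3

theorem Sv_iff [IsDomain B] (φ : B →+* κ) {τ x w r : B} (h : IsPt τ x w)
    (hr : ev pcL r - τ * ev qcL r = 0) {j i} (hx : φ x = (xx j : κ)) (hw : φ w = (ww j : κ))
    (hc : φ r = (cc i : κ)) : Sv x w r = 0 ↔ inc j i = true := by
  have hm := Sv_mul h hr
  have h1 := chk_inc j i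
  cases hi : inc j i
  · simp only [hi, Bool.false_eq_true, if_false] at h1
    simp only [Bool.false_eq_true, iff_false]
    intro h0
    apply h1
    rw [← z547 (κ := κ)]
    have := congrArg φ h0
    rw [Sv] at this
    simp only [map_add, map_mul, map_ev2, hx, hw, hc, ev2_cast, map_zero] at this
    push_cast
    exact this
  · simp only [hi, if_true] at h1
    simp only [iff_true]
    rcases mul_eq_zero.1 hm with h0 | h0
    · exact h0
    · exfalso
      apply h1
      rw [← z547 (κ := κ)]
      have := congrArg φ h0
      rw [Uv] at this
      simp only [map_add, map_mul, map_ev2, hx, hw, hc, ev2_cast, map_zero] at this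
      push_cast
      exact this


theorem IsPt.map (s : B →+* B) {τ x w : B} (hs : s τ = τ) (h : IsPt τ x w) :
    IsPt τ (s x) (s w) := by
  obtain ⟨h1, h2, h3⟩ := h
  refine ⟨?_, ?_, ?_⟩
  · have := congrArg s h1
    simpa only [map_add, map_sub, map_mul, map_pow, map_ev, hs, map_zero, map_ofNat] using this
  · have := congrArg s h2
    simpa only [map_pow, map_ev] using this
  · have := congrArg s h3
    simpa only [map_add, map_mul, map_ev, hs] using this

theorem perm_mem [IsDomain B] (φ : B →+* κ) {τ : B} (hτ : φ τ = ((310 : ℤ) : κ))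
    (hpt : ∀ j : Fin 22, ∃ x w : B, IsPt τ x w ∧ φ x = (xx j : κ) ∧ φ w = (ww j : κ))
    (r : Fin 12 → B) (hr : ∀ i, ev pcL (r i) - τ * ev qcL (r i) = 0)
    (hc : ∀ i, φ (r i) = (cc i : κ))
    (s : B →+* B) (hs : s τ = τ) (hinj : Function.Injective s) (π : P12)
    (hπ : ∀ i, s (r i) = r (π i)) : π ∈ Γ := by
  rw [mem_Γ]
  intro j
  obtain ⟨x, w, hp, hx, hw⟩ := hpt j
  have hp2 := hp.map s hs
  obtain ⟨j', hx', hw'⟩ := pt_red φ hτ hp2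
  refine ⟨j', fun i => ?_⟩
  have e1 := Sv_iff φ hp (hr i) hx hw (hc i)
  have e2 := Sv_iff φ hp2 (hr (π i)) hx' hw' (hc (π i))
  have e3 : Sv (s x) (s w) (r (π i)) = s (Sv x w (r i)) := by
    rw [Sv, Sv, map_add, map_mul, map_ev2, map_ev2, hπ]
  rw [e3, map_eq_zero_iff s hinj, e1] at e2
  rw [Bool.eq_iff_iff, e2]

end pts

theorem exists_pt {Ω κ : Type*} [Field Ω] [IsAlgClosed Ω] [Algebra ℤ[X] Ω] [Field κ] [CharP κ 547]
    (φ : integralClosure ℤ[X] Ω →+* κ) (hτ : φ (algebraMap ℤ[X] _ X) = ((310 : ℤ) : κ))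
    (j : Fin 22) : ∃ x w : integralClosure ℤ[X] Ω,
      IsPt (algebraMap ℤ[X] (integralClosure ℤ[X] Ω) X) x w ∧
        φ x = (xx j : κ) ∧ φ w = (ww j : κ) := by
  have p0 : ((547 : ℤ) : κ) = 0 := (z547 547).2 rfl
  have b1 : ((ev le (xx j) : ℤ) : κ) ≠ 0 := fun h => chk_le j ((z547 _).1 h)
  have b2 := (z547 (κ := κ) _).2 (chk_w j)
  obtain ⟨x, hx, hφ⟩ := lift_root F22 (IsAlgClosed.splits _) F22_monic φ (xx j : κ) (by
    rw [F22_eval, RingHom.comp_apply, hτ]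
    have a4 := ev_normL (547 : ℤ) p0 (addL l22 (smulL (-1) (prodL (List.ofFn xx)))) (xx j : κ)
    have a5 : ev (prodL (List.ofFn xx)) (xx j : κ) = 0 := by
      have : ∀ l : List ℤ, ∀ a ∈ l, ev (prodL l) (a : κ) = 0 := by
        intro l
        induction l with
        | nil => simp
        | cons b l ih =>
          intro a ha
          rw [prodL, ev_mulL]
          rcases List.mem_cons.1 ha with rfl | h
          · simp [ev]
          · rw [ih a h, mul_zero]
      exact this _ _ (by rw [List.mem_ofFn]; exact ⟨j, rfl⟩)
    rw [id4, ev_addL, ev_smulL, a5, l22] at a4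
    simp only [ev_addL, ev_smulL, ev_cons] at a4
    simp only [ev] at a4
    push_cast at a4 ⊢
    linear_combination -a4)
  set τ := algebraMap ℤ[X] (integralClosure ℤ[X] Ω) X with hτd
  rw [F22_eval, ← hτd] at hx
  have hle : ev le (x : Ω) ≠ 0 := by
    intro h
    have : ev le x = 0 := by
      apply Subtype.val_injective
      refine Eq.trans ?_ h
      exact map_ev (algebraMap (integralClosure ℤ[X] Ω) Ω) le x
    have h2 := congrArg φ this
    rw [map_ev, hφ, ev_cast, map_zero] at h2
    exact b1 h2
  set w0 : Ω := ((τ : Ω) * ev ld (x : Ω) - ev ln (x : Ω)) / ev le (x : Ω) with hw0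
  have c1 : w0 * ev le (x : Ω) = (τ : Ω) * ev ld (x : Ω) - ev ln (x : Ω) := by
    rw [hw0, div_mul_cancel₀ _ hle]
  have hxΩ : ev (lm ++ [1]) (x : Ω) + 2 * (τ : Ω) * ((x : Ω) * ev ln (x : Ω)) -
      (τ : Ω) ^ 2 * ((x : Ω) * ((x : Ω) * ev la (x : Ω))) = 0 := by
    have := congrArg (algebraMap (integralClosure ℤ[X] Ω) Ω) hx
    simp only [map_add, map_sub, map_mul, map_pow, map_ev, map_zero, map_ofNat] at this
    exact this
  have c2 : w0 ^ 2 = ev lq (x : Ω) := by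
    have h3 := ev_eqL id3 (x : Ω)
    simp only [ev_addL, ev_smulL, ev_mulL] at h3
    push_cast at h3
    have hd : ev ld (x : Ω) = x * ev la (x : Ω) := by rw [ld, ev_cons]; simp
    apply mul_right_cancel₀ (pow_ne_zero 2 hle)
    rw [hd] at c1
    linear_combination (w0 * ev le (x : Ω) + ((τ : Ω) * (x * ev la (x : Ω)) - ev ln (x : Ω))) * c1 +
      h3 - ev la (x : Ω) * hxΩ
  have hint : w0 ∈ integralClosure ℤ[X] Ω := by
    refine IsIntegral.of_pow (n := 2) (by norm_num) ?_
    rw [c2]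
    have : ev lq (x : Ω) = ((ev lq x : integralClosure ℤ[X] Ω) : Ω) :=
      (map_ev (algebraMap (integralClosure ℤ[X] Ω) Ω) lq x).symm
    rw [this]
    exact (ev lq x).2
  have hval : Function.Injective (algebraMap (integralClosure ℤ[X] Ω) Ω) := Subtype.val_injective
  have e3 : τ * ev ld x = ev ln x + ev le x * (⟨w0, hint⟩ : integralClosure ℤ[X] Ω) := by
    apply hval
    simp only [map_add, map_mul, map_ev]
    change (τ : Ω) * ev ld (x : Ω) = ev ln (x : Ω) + ev le (x : Ω) * w0
    linear_combination -c1
  refine ⟨x, ⟨w0, hint⟩, ⟨hx, ?_, e3⟩, hφ, ?_⟩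
  · apply hval
    simp only [map_pow, map_ev]
    exact c2
  · have a3 := congrArg φ e3
    simp only [map_add, map_mul, map_ev, hτ, hφ, ev_cast] at a3
    push_cast at b2 a3
    apply mul_left_cancel₀ b1
    linear_combination b2 - a3

end M11

namespace M11

noncomputable instance algK : Algebra ℤ[X] (RatFunc ℚ) :=
  ((algebraMap ℚ[X] (RatFunc ℚ)).comp (mapRingHom (Int.castRingHom ℚ))).toAlgebra

theorem algK_apply (a : ℤ[X]) :
    algebraMap ℤ[X] (RatFunc ℚ) a = algebraMap ℚ[X] (RatFunc ℚ) (a.map (Int.castRingHom ℚ)) := rfl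

theorem algK_inj : Function.Injective (algebraMap ℤ[X] (RatFunc ℚ)) := by
  intro a b h
  rw [algK_apply, algK_apply] at h
  have h2 := (IsFractionRing.injective ℚ[X] (RatFunc ℚ)) h
  exact Polynomial.map_injective _ Int.cast_injective h2

theorem clear_den (a : ℚ[X]) : ∃ (n : ℤ) (b : ℤ[X]), n ≠ 0 ∧
    b.map (Int.castRingHom ℚ) = C (n : ℚ) * a := by
  obtain ⟨n, hM, hn⟩ := IsLocalization.integerNormalization_spec (nonZeroDivisors ℤ) a
  refine ⟨n, _, nonZeroDivisors.ne_zero hM, hn.trans ?_⟩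
  ext k
  simp

instance fracK : IsFractionRing ℤ[X] (RatFunc ℚ) := by
  have : FaithfulSMul ℤ[X] (RatFunc ℚ) := (faithfulSMul_iff_algebraMap_injective _ _).2 algK_inj
  apply IsFractionRing.of_field
  intro z
  obtain ⟨n, b, hn, hb⟩ := clear_den z.num
  obtain ⟨m, d, hm, hd⟩ := clear_den z.denom
  refine ⟨C m * b, C n * d, ?_⟩
  rw [algK_apply, algK_apply, Polynomial.map_mul, Polynomial.map_mul, hb, hd]
  have h1 : algebraMap ℚ[X] (RatFunc ℚ) (C (n : ℚ)) ≠ 0 := by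
    rw [Ne, map_eq_zero_iff _ (IsFractionRing.injective ℚ[X] (RatFunc ℚ))]
    simpa using hn
  have h2 : algebraMap ℚ[X] (RatFunc ℚ) (C (m : ℚ)) ≠ 0 := by
    rw [Ne, map_eq_zero_iff _ (IsFractionRing.injective ℚ[X] (RatFunc ℚ))]
    simpa using hm
  rw [Polynomial.map_C, Polynomial.map_C, map_mul, map_mul, map_mul, map_mul, eq_intCast, eq_intCast]
  conv_lhs => rw [← RatFunc.num_div_denom z]
  have h3 : algebraMap ℚ[X] (RatFunc ℚ) z.denom ≠ 0 := RatFunc.algebraMap_ne_zero z.denom_ne_zero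
  field_simp

theorem f_eq : f = F12.map (algebraMap ℤ[X] (RatFunc ℚ)) := by
  have h := F12_eval (mapRingHom (algebraMap ℤ[X] (RatFunc ℚ)) |>.comp C) X
  have h2 : F12.map (algebraMap ℤ[X] (RatFunc ℚ)) =
      F12.eval₂ ((mapRingHom (algebraMap ℤ[X] (RatFunc ℚ))).comp C) X := by
    rw [Polynomial.map]
    congr 1
    ext a <;> simp
  rw [h2, h]
  have h3 : ((mapRingHom (algebraMap ℤ[X] (RatFunc ℚ))).comp C) (X : ℤ[X]) = C t := by
    simp [algK_apply, t]
  have h4 : qcL = [-16, -48, 0, 64, 24, -24, -16, 0, 3, 1] := by decide +kernel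
  rw [h3, f, h4, pcL]
  simp only [ev]
  push_cast
  ring

theorem f_monic : f.Monic := by rw [f_eq]; exact F12_monic.map _

theorem F12_natDegree : F12.natDegree = 12 := by
  have : F12.degree = ((12 : ℕ) : WithBot ℕ) := by
    rw [F12, degree_add_eq_left_of_degree_lt, degree_X_pow]
    rw [degree_X_pow]
    refine lt_of_le_of_lt (degree_sub_le _ _) (max_lt (toP_degree pc0) ?_)
    refine lt_of_le_of_lt (degree_mul_le _ _) ?_
    refine lt_of_le_of_lt (add_le_add_left degree_C_le _) ?_
    rw [zero_add]
    refine lt_trans (toP_degree qcL) ?_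
    have : qcL.length = 10 := by decide +kernel
    rw [this]; norm_num
  exact natDegree_eq_of_degree_eq_some this

theorem f_natDegree : f.natDegree = 12 := by
  rw [f_eq, F12_monic.natDegree_map, F12_natDegree]

theorem card_dvd : 1320 ∣ Nat.card f.Gal := by
  have h : IsGalois (RatFunc ℚ) f.SplittingField := by
    constructor
  refine dvd1320 (K := RatFunc ℚ) (L := f.SplittingField) ?_
  have := SplittingField.splits f
  have h2 : f.map (algebraMap (RatFunc ℚ) f.SplittingField) =
      F12.map (algebraMap ℤ[X] f.SplittingField) := by
    rw [IsScalarTower.algebraMap_eq ℤ[X] (RatFunc ℚ) f.SplittingField, ← Polynomial.map_map, ← f_eq]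
  rwa [h2] at this

abbrev Ω := AlgebraicClosure (RatFunc ℚ)
noncomputable abbrev BB := integralClosure ℤ[X] Ω

theorem inj_Ω : Function.Injective (algebraMap ℤ[X] Ω) := by
  rw [IsScalarTower.algebraMap_eq ℤ[X] (RatFunc ℚ) Ω]
  exact (algebraMap (RatFunc ℚ) Ω).injective.comp algK_inj

theorem roots_data : ∃ r : Fin 12 → Ω, Function.Injective r ∧ (∀ i, r i ∈ f.rootSet Ω) ∧
    ∀ (σ : Ω ≃ₐ[RatFunc ℚ] Ω) (π : P12), (∀ i, σ (r i) = r (π i)) → π ∈ Γ := by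
  have := Fact.mk (show Nat.Prime 547 by norm_num)
  obtain ⟨Q, hQm, hQ⟩ := exists_place inj_Ω 547 310
  obtain ⟨h1, h2⟩ := place_props 547 310 Q hQ
  let _ : Field (BB ⧸ Q) := Ideal.Quotient.field Q
  let φ : BB →+* BB ⧸ Q := Ideal.Quotient.mk Q
  have hl : ∀ i : Fin 12, ∃ b : BB, F12.eval₂ (algebraMap ℤ[X] _) b = 0 ∧
      φ b = (cc i : BB ⧸ Q) := by
    intro i
    apply lift_root F12 (IsAlgClosed.splits _) F12_monic φ
    rw [F12_eval, RingHom.comp_apply]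
    have e := (z547 (κ := BB ⧸ Q) _).2 (chk_root i)
    have e2 : φ (algebraMap ℤ[X] BB X) = ((310 : ℤ) : BB ⧸ Q) := h1
    rw [e2, ev_cast, ev_cast]
    push_cast at e ⊢
    exact e
  choose r hr hc using hl
  refine ⟨fun i => r i, ?_, ?_, ?_⟩
  · intro i j hij
    have : r i = r j := Subtype.val_injective hij
    have h3 : (cc i : BB ⧸ Q) = cc j := by rw [← hc, ← hc, this]
    apply cc_inj
    rw [← z547 (κ := BB ⧸ Q)]
    push_cast
    rw [h3, sub_self]
  · intro i
    rw [mem_rootSet]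
    refine ⟨f_monic.ne_zero, ?_⟩
    have := congrArg (algebraMap BB Ω) (hr i)
    rw [hom_eval₂, ← IsScalarTower.algebraMap_eq, map_zero] at this
    rw [f_eq, aeval_def, eval₂_map, ← IsScalarTower.algebraMap_eq]
    exact this
  · intro σ π hσ
    let s0 : Ω →ₐ[ℤ[X]] Ω := (σ : Ω →ₐ[RatFunc ℚ] Ω).restrictScalars ℤ[X]
    have hs0 : ∀ b : BB, s0 b ∈ integralClosure ℤ[X] Ω := fun b => IsIntegral.map s0 b.2
    let s : BB →+* BB := (s0.toRingHom.comp (algebraMap BB Ω)).codRestrict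
      (integralClosure ℤ[X] Ω).toSubring hs0
    have hsv : ∀ b : BB, ((s b : BB) : Ω) = σ b := fun b => rfl
    refine perm_mem (B := BB) φ (τ := algebraMap ℤ[X] BB X) h1 (exists_pt φ h1) r ?_ hc s ?_ ?_ π ?_
    · intro i
      rw [← F12_eval]; exact hr i
    · apply Subtype.val_injective
      rw [hsv]
      exact s0.commutes X
    · intro a b hab
      apply Subtype.val_injective
      apply σ.injective
      rw [← hsv, ← hsv, hab]
    · intro i
      apply Subtype.val_injective
      rw [hsv]; exact hσ i

theorem main : IsSimpleGroup f.Gal ∧ Nat.card f.Gal = 7920 := by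
  obtain ⟨r, hinj, hmem, hΓ⟩ := roots_data
  have hsp : Fact (f.map (algebraMap (RatFunc ℚ) Ω)).Splits := ⟨IsAlgClosed.splits _⟩
  let r' : Fin 12 → f.rootSet Ω := fun i => ⟨r i, hmem i⟩
  have hi' : Function.Injective r' := fun i j h => hinj (congrArg Subtype.val h)
  have hb : Function.Bijective r' := by
    rw [Fintype.bijective_iff_injective_and_card]
    refine ⟨hi', le_antisymm (Fintype.card_le_of_injective r' hi') ?_⟩
    rw [Fintype.card_fin, ← f_natDegree, ← Nat.card_eq_fintype_card, Nat.card_coe_set_eq]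
    exact ncard_rootSet_le f Ω
  let ρ : Fin 12 ≃ f.rootSet Ω := Equiv.ofBijective r' hb
  let θ : f.Gal →* P12 := (ρ.symm.permCongrHom.toMonoidHom).comp (Gal.galActionHom f Ω)
  have hθi : Function.Injective θ :=
    ρ.symm.permCongrHom.injective.comp (Gal.galActionHom_injective f Ω)
  have hle : θ.range ≤ Γ := by
    rintro _ ⟨g, rfl⟩
    obtain ⟨σ, rfl⟩ := Gal.restrict_surjective f Ω g
    apply hΓ σ
    intro i
    have e1 : θ (Gal.restrict f Ω σ) i = ρ.symm (Gal.restrict f Ω σ • ρ i) := rfl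
    have e2 : ∀ k, r k = (ρ k : Ω) := fun k => rfl
    rw [e1, e2, e2, Equiv.apply_symm_apply, Gal.restrict_smul]
  let e := MonoidHom.ofInjective hθi
  have hcard : 1320 ∣ Nat.card θ.range := by
    rw [← Nat.card_congr e.toEquiv]; exact card_dvd
  have hEq := eq_Γ _ hle hcard
  let e' : f.Gal ≃* Γ := e.trans (MulEquiv.subgroupCongr hEq)
  have := simple_Γ
  exact ⟨MulEquiv.isSimpleGroup e', by rw [Nat.card_congr e'.toEquiv, card_Γ]⟩

end M11

theorem m11_five_branch_points_f :
    f.natDegree = 12 ∧ IsSimpleGroup f.Gal ∧ Nat.card f.Gal = 7920 :=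
  ⟨M11.f_natDegree, M11.main⟩
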